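/- Let E be a finite homogeneous effect algebra such that S(E) = {0, 1}, and let {a₁, …, a_k} be the set of all atoms of E. Then E is a horizontal sum of chains; explicitly: E = {0, 1} ∪ ⋃_{i=1}^{k} [a_i, a_i'], each interval [a_i, a_i'] is a chain (totally ordered), the intervals [a_i, a_i'] are pairwise disjoint, and whenever x ∈ [a_i, a_i'], y ∈ [a_j, a_j'] with i ≠ j, x and y are incomparable. -/

import Mathlib

namespace EffectAlgebraPaper

/-- An effect algebra: a set with 0, 1 and a partially defined sum `add`,
whose domain is the relation `Orth` (written `a ⊥ b` in the paper). -/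
class EffectAlgebra (E : Type*) where
  zero : E
  one : E
  /-- `Orth a b` means `a ⊕ b` is defined. -/
  Orth : E → E → Prop
  /-- The sum `a ⊕ b`, meaningful only when `Orth a b`. -/
  add : E → E → E
  orth_comm : ∀ a b : E, Orth a b → Orth b a
  add_comm : ∀ a b : E, Orth a b → add a b = add b a
  assoc : ∀ a b c : E, Orth b c → Orth a (add b c) →
    Orth a b ∧ Orth (add a b) c ∧ add a (add b c) = add (add a b) c
  compl_exists : ∀ a : E, ∃! b : E, Orth a b ∧ add a b = one
  orth_one : ∀ a : E, Orth a one → a = zero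

namespace EffectAlgebra

variable {E : Type*} [EffectAlgebra E]

/-- The orthosupplement `a'`. -/
noncomputable def compl (a : E) : E := (compl_exists a).exists.choose

/-- The effect-algebra partial order: `a ≤ b` iff `a ⊕ c = b` for some `c`. -/
def le (a b : E) : Prop := ∃ c : E, Orth a c ∧ add a c = b

/-- The interval `[x, y] = {z : x ≤ z ≤ y}`. -/
def Interval (x y : E) : Set E := { z : E | le x z ∧ le z y }

/-- An atom: a minimal nonzero element. -/
def Atom (a : E) : Prop := a ≠ zero ∧ ∀ b : E, b ≠ zero → le b a → b = a

/-- A sharp element: the only common lower bound of `x` and `x'` is `0`. -/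
def Sharp (x : E) : Prop := ∀ b : E, le b x → le b (compl x) → b = zero

/-- `S(E)`, the set of sharp elements. -/
def sharpSet (E : Type*) [EffectAlgebra E] : Set E := { x : E | Sharp x }

/-- Homogeneity: `u ≤ v₁ ⊕ v₂ ≤ u'` implies `u = u₁ ⊕ u₂` with `u₁ ≤ v₁`, `u₂ ≤ v₂`. -/
def Homogeneous (E : Type*) [EffectAlgebra E] : Prop :=
  ∀ u v₁ v₂ : E, Orth v₁ v₂ → le u (add v₁ v₂) → le (add v₁ v₂) (compl u) →
    ∃ u₁ u₂ : E, le u₁ v₁ ∧ le u₂ v₂ ∧ Orth u₁ u₂ ∧ add u₁ u₂ = u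

/-- `nmul n a` is the iterated sum `n·a = a ⊕ ⋯ ⊕ a` (`n` times), with `0·a = 0`;
it is meaningful only when `nmulDef n a` holds. -/
def nmul : ℕ → E → E
  | 0, _ => zero
  | n + 1, a => add (nmul n a) a

/-- `nmulDef n a` says the iterated sum `n·a` is well defined. -/
def nmulDef : ℕ → E → Prop
  | 0, _ => True
  | n + 1, a => nmulDef n a ∧ Orth (nmul n a) a

end EffectAlgebra

open EffectAlgebra

namespace EffectAlgebra

variable {E : Type*} [EffectAlgebra E]

/-- The graph of the partial sum: `a ⊕ b` is defined and equal to `c`. -/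
def IsSum (a b c : E) : Prop := Orth a b ∧ add a b = c

namespace IsSum

theorem comm {a b c : E} (h : IsSum a b c) : IsSum b a c :=
  ⟨orth_comm _ _ h.1, (EffectAlgebra.add_comm _ _ h.1).symm.trans h.2⟩

theorem unique {a b c d : E} (h : IsSum a b c) (h' : IsSum a b d) : c = d :=
  h.2.symm.trans h'.2

theorem assoc_left {a b c d e : E} (h : IsSum b c d) (h' : IsSum a d e) :
    ∃ f, IsSum a b f ∧ IsSum f c e := by
  obtain ⟨h1, rfl⟩ := h
  obtain ⟨h2, rfl⟩ := h'
  obtain ⟨h3, h4, h5⟩ := EffectAlgebra.assoc a b c h1 h2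
  exact ⟨_, ⟨h3, rfl⟩, h4, h5.symm⟩

theorem assoc_right {a b c d e : E} (h : IsSum a b d) (h' : IsSum d c e) :
    ∃ f, IsSum b c f ∧ IsSum a f e := by
  obtain ⟨f, hf, hf'⟩ := assoc_left h.comm h'.comm
  exact ⟨f, hf.comm, hf'.comm⟩

/-- `(a ⊕ b) ⊕ c = (a ⊕ c) ⊕ b`. -/
theorem right_comm {a b c d e : E} (h : IsSum a b d) (h' : IsSum d c e) :
    ∃ f, IsSum a c f ∧ IsSum f b e := by
  obtain ⟨f, hf, hf'⟩ := assoc_right h h'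
  exact assoc_left hf.comm hf'

end IsSum

theorem isSum_compl (a : E) : IsSum a (compl a) one := (compl_exists a).exists.choose_spec

theorem IsSum.eq_compl {a b : E} (h : IsSum a b one) : b = compl a :=
  (compl_exists a).unique h (isSum_compl a)

theorem compl_compl (a : E) : compl (compl a) = a := (isSum_compl a).comm.eq_compl.symm

theorem IsSum.left_cancel {a b c d : E} (h : IsSum a b d) (h' : IsSum a c d) : b = c := by
  obtain ⟨g, hg, hb⟩ := IsSum.assoc_right h.comm (isSum_compl d)
  obtain ⟨g', hg', hc⟩ := IsSum.assoc_right h'.comm (isSum_compl d)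
  obtain rfl := hg.unique hg'
  rw [hb.comm.eq_compl, hc.comm.eq_compl]

theorem isSum_zero (a : E) : IsSum a zero a := by
  have h1 : IsSum (one : E) zero one := by
    have h := isSum_compl (one : E)
    rwa [orth_one _ (orth_comm _ _ h.1)] at h
  obtain ⟨f, hf, hf'⟩ := IsSum.assoc_right (isSum_compl (compl a)) h1
  rwa [hf'.eq_compl, compl_compl] at hf

theorem IsSum.right_eq_zero {a b : E} (h : IsSum a b a) : b = zero :=
  h.left_cancel (isSum_zero a)

theorem IsSum.eq_zero {a b : E} (h : IsSum a b zero) : a = zero := by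
  obtain ⟨f, hf, -⟩ := IsSum.assoc_right h (isSum_zero one).comm
  obtain rfl := orth_one _ hf.1
  exact (isSum_zero a).unique h

theorem le_refl (a : E) : le a a := ⟨zero, isSum_zero a⟩

theorem zero_le (a : E) : le zero a := ⟨a, (isSum_zero a).comm⟩

theorem le_trans {a b c : E} : le a b → le b c → le a c := by
  rintro ⟨x, hx⟩ ⟨y, hy⟩
  obtain ⟨f, -, hf⟩ := IsSum.assoc_right hx hy
  exact ⟨f, hf⟩

theorem le_antisymm {a b : E} : le a b → le b a → a = b := by
  rintro ⟨x, hx⟩ ⟨y, hy⟩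
  obtain ⟨f, hf, hf'⟩ := IsSum.assoc_right hx hy
  obtain rfl := hf'.right_eq_zero
  obtain rfl := hf.eq_zero
  exact (isSum_zero a).unique hx

theorem IsSum.le_left {a b c : E} (h : IsSum a b c) : le a c := ⟨b, h⟩

theorem IsSum.le_right {a b c : E} (h : IsSum a b c) : le b c := ⟨a, h.comm⟩

theorem le_zero {a : E} (h : le a zero) : a = zero := le_antisymm h (zero_le a)

theorem le_compl_iff_orth {x y : E} : le x (compl y) ↔ Orth x y := by
  constructor
  · rintro ⟨c, hc⟩
    obtain ⟨f, hf, -⟩ := IsSum.assoc_left hc (isSum_compl y)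
    exact hf.comm.1
  · intro h
    obtain ⟨g, hg, hg'⟩ := IsSum.assoc_right (IsSum.comm ⟨h, rfl⟩) (isSum_compl (add x y))
    exact hg'.eq_compl ▸ hg.le_left

variable (E) in
/-- The partial order of an effect algebra. -/
@[reducible] def toPartialOrder : PartialOrder E where
  le := le
  le_refl := le_refl
  le_trans _ _ _ := le_trans
  le_antisymm _ _ := le_antisymm

theorem exists_atom_le [Finite E] {b : E} (hb : b ≠ zero) : ∃ a, Atom a ∧ le a b := by
  let _ := toPartialOrder E
  obtain ⟨a, ha⟩ := (Set.toFinite {c : E | c ≠ zero ∧ le c b}).exists_minimal ⟨b, hb, le_refl b⟩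
  exact ⟨a, ⟨ha.prop.1, fun c hc hca =>
    le_antisymm hca (ha.le_of_le ⟨hc, le_trans hca ha.prop.2⟩ hca)⟩, ha.prop.2⟩

theorem Atom.le_cases {a b : E} (ha : Atom a) (h : le b a) : b = zero ∨ b = a :=
  or_iff_not_imp_left.2 fun hb => ha.2 b hb h

/-- An atom splits only trivially. -/
theorem Atom.eq_or_eq_of_isSum {a b c : E} (ha : Atom a) (h : IsSum b c a) : b = a ∨ c = a := by
  rcases ha.le_cases h.le_left with rfl | hb
  · exact .inr ((isSum_zero c).comm.unique h)
  · exact .inl hb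

/-- `x` is a finite sum `a ⊕ ⋯ ⊕ a`. -/
inductive IsMultiple (a : E) : E → Prop
  | zero : IsMultiple a zero
  | step {x y : E} : IsMultiple a x → IsSum x a y → IsMultiple a y

theorem IsMultiple.eq_zero_or_exists_isSum {a x : E} (h : IsMultiple a x) :
    x = EffectAlgebra.zero ∨ ∃ y, IsMultiple a y ∧ IsSum y a x := by
  cases h with
  | zero => exact .inl rfl
  | step hy hs => exact .inr ⟨_, hy, hs⟩

theorem IsMultiple.eq_zero_or_le {a x : E} (h : IsMultiple a x) :
    x = EffectAlgebra.zero ∨ le a x :=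
  h.eq_zero_or_exists_isSum.imp_right fun ⟨_, _, hs⟩ => hs.le_right

theorem IsMultiple.le_total {a x y : E} (hx : IsMultiple a x) (hy : IsMultiple a y) :
    le x y ∨ le y x := by
  induction hx generalizing y with
  | zero => exact .inl (zero_le y)
  | step _ hs ih =>
    cases hy with
    | zero => exact .inr (zero_le _)
    | step hy hs' =>
      rcases ih hy with ⟨c, hc⟩ | ⟨c, hc⟩
      · obtain ⟨f, hf, hf'⟩ := IsSum.right_comm hc hs'
        exact .inl (hs.unique hf ▸ hf'.le_left)
      · obtain ⟨f, hf, hf'⟩ := IsSum.right_comm hc hs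
        exact .inr (hs'.unique hf ▸ hf'.le_left)

/-- An element orthogonal to a multiple of an atom and lying below it is zero or above the atom. -/
theorem IsMultiple.eq_zero_or_le_of_le (hhom : Homogeneous E) {a x b : E} (ha : Atom a)
    (hx : IsMultiple a x) (hb : le b x) (hxb : le x (compl b)) :
    b = EffectAlgebra.zero ∨ le a b := by
  induction hx with
  | zero => exact .inl (le_zero hb)
  | step _ hs ih =>
    obtain ⟨ho, rfl⟩ := hs
    obtain ⟨u, v, hu, hv, huv⟩ := hhom b _ a ho hb hxb
    rcases ha.le_cases hv with rfl | rfl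
    · obtain rfl := (isSum_zero u).unique huv
      exact ih hu (le_trans (IsSum.le_left ⟨ho, rfl⟩) hxb)
    · exact .inr (IsSum.le_right huv)

/-- Summands of a non-maximal multiple of an atom are multiples of that atom. -/
theorem IsMultiple.of_isSum (hhom : Homogeneous E) {a x p q : E} (ha : Atom a)
    (hx : IsMultiple a x) (hxa : Orth x a) (h : IsSum p q x) :
    IsMultiple a p ∧ IsMultiple a q := by
  induction hx generalizing p q with
  | zero =>
    obtain rfl := h.eq_zero
    obtain rfl := h.comm.eq_zero
    exact ⟨.zero, .zero⟩
  | @step y z _ hs ih =>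
    have hya : Orth y a := hs.1
    have hsplit : le a p ∨ le a q := by
      obtain ⟨ho, rfl⟩ := h
      obtain ⟨u, v, hu, hv, huv⟩ := hhom a p q ho hs.le_right (le_compl_iff_orth.2 hxa)
      rcases ha.eq_or_eq_of_isSum huv with rfl | rfl
      · exact .inl hu
      · exact .inr hv
    have key {p q : E} (h : IsSum p q z) (hp : le a p) : IsMultiple a p ∧ IsMultiple a q := by
      obtain ⟨r, hr⟩ := hp
      obtain ⟨f, hf, hf'⟩ := IsSum.assoc_right hr h
      obtain rfl := hf'.left_cancel hs.comm
      obtain ⟨h1, h2⟩ := ih hya hf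
      exact ⟨h1.step (IsSum.comm hr), h2⟩
    rcases hsplit with hp | hq
    · exact key h hp
    · exact (key h.comm hq).symm

/-- If only `0` and `1` are sharp, the orthosupplement of an atom is a multiple of that atom. -/
theorem Atom.isMultiple_compl [Finite E] (hhom : Homogeneous E) (hS : sharpSet E = {zero, one})
    {a : E} (ha : Atom a) : IsMultiple a (compl a) := by
  let _ := toPartialOrder E
  obtain ⟨x, hx⟩ := (Set.toFinite {c : E | IsMultiple a c}).exists_maximal ⟨zero, .zero⟩
  have hm : IsMultiple a x := hx.prop
  have hxa : ¬ Orth x a := by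
    intro h
    have hs : IsSum x a (add x a) := ⟨h, rfl⟩
    have := le_antisymm hs.le_left (hx.le_of_ge (hm.step hs) hs.le_left)
    exact ha.1 (IsSum.right_eq_zero (a := x) ⟨h, this.symm⟩)
  have hsharp : x ∈ sharpSet E := by
    intro b hb hb'
    have hxb : le x (compl b) := le_compl_iff_orth.2 (orth_comm _ _ (le_compl_iff_orth.1 hb'))
    refine (hm.eq_zero_or_le_of_le hhom ha hb hxb).resolve_right fun hab => hxa ?_
    exact orth_comm _ _ (le_compl_iff_orth.1 (le_trans hab hb'))
  rw [hS] at hsharp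
  rcases hsharp with rfl | rfl
  · exact absurd (isSum_zero a).comm.1 hxa
  · rcases hm.eq_zero_or_exists_isSum with h0 | ⟨y, hy, hs⟩
    · exact absurd (h0 ▸ (isSum_zero a).comm.1) hxa
    · exact hs.comm.eq_compl ▸ hy

theorem Atom.isMultiple_of_le_compl [Finite E] (hhom : Homogeneous E)
    (hS : sharpSet E = {zero, one}) {a x : E} (ha : Atom a) (hx : le x (compl a)) :
    IsMultiple a x := by
  obtain ⟨c, hc⟩ := hx
  exact ((ha.isMultiple_compl hhom hS).of_isSum hhom ha (isSum_compl a).comm.1 hc).1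

theorem Atom.eq_of_le_compl [Finite E] (hhom : Homogeneous E)
    (hS : sharpSet E = {zero, one}) {a b : E} (ha : Atom a) (hb : Atom b)
    (h : le a (compl b)) : a = b :=
  (ha.2 b hb.1 ((hb.isMultiple_of_le_compl hhom hS h).eq_zero_or_le.resolve_left ha.1)).symm

end EffectAlgebra

/-- Corollary 2 (cor2): a finite homogeneous effect algebra with `S(E) = {0, 1}` is a
horizontal sum of chains: `E = {0,1} ∪ ⋃_{a atom} [a, a']`, each `[a, a']` is a chain,
the intervals are pairwise disjoint, and elements of intervals of distinct atoms are
incomparable. -/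
theorem stmt10 {E : Type*} [EffectAlgebra E] [Finite E] (hhom : Homogeneous E)
    (hS : sharpSet E = {zero, one}) :
    ((Set.univ : Set E) =
        {zero, one} ∪ ⋃ a ∈ { a : E | Atom a }, Interval a (compl a)) ∧
    (∀ a : E, Atom a → IsChain (fun x y : E => le x y) (Interval a (compl a))) ∧
    (∀ a b : E, Atom a → Atom b → a ≠ b →
        Interval a (compl a) ∩ Interval b (compl b) = ∅) ∧
    (∀ a b : E, Atom a → Atom b → a ≠ b →
        ∀ x ∈ Interval a (compl a), ∀ y ∈ Interval b (compl b),
          ¬ le x y ∧ ¬ le y x) := by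
  have hinc : ∀ a b : E, Atom a → Atom b → a ≠ b →
      ∀ x ∈ Interval a (compl a), ∀ y ∈ Interval b (compl b), ¬ le x y :=
    fun a b ha hb hab x hx y hy hxy =>
      hab (ha.eq_of_le_compl hhom hS hb (le_trans hx.1 (le_trans hxy hy.2)))
  refine ⟨?_, ?_, ?_, ?_⟩
  · symm
    rw [Set.eq_univ_iff_forall]
    intro x
    by_cases hx : x ∈ ({zero, one} : Set E)
    · exact .inl hx
    · right
      rw [← hS] at hx
      obtain ⟨b, hbx, hbx', hb⟩ : ∃ b, le b x ∧ le b (compl x) ∧ b ≠ zero := by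
        simpa [sharpSet, Sharp] using hx
      obtain ⟨a, ha, hab⟩ := exists_atom_le hb
      refine Set.mem_biUnion ha ⟨le_trans hab hbx, ?_⟩
      exact le_compl_iff_orth.2 (orth_comm _ _ (le_compl_iff_orth.1 (le_trans hab hbx')))
  · intro a ha x hx y hy _
    exact (ha.isMultiple_of_le_compl hhom hS hx.2).le_total
      (ha.isMultiple_of_le_compl hhom hS hy.2)
  · intro a b ha hb hab
    rw [Set.eq_empty_iff_forall_notMem]
    exact fun x hx => hinc a b ha hb hab x hx.1 x hx.2 (le_refl x)
  · exact fun a b ha hb hab x hx y hy =>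
      ⟨hinc a b ha hb hab x hx y hy, hinc b a hb ha hab.symm y hy x hx⟩

end EffectAlgebraPaper
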